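/- Let μ be a singular cardinal (μ infinite with cf(μ) < μ). Then μ⁺ carries no dense ideal: there is no normal, fine, μ⁺-complete proper ideal I over μ⁺ for which there exists a family D of I-positive subsets of μ⁺ with |D| ≤ μ⁺ such that for every I-positive A ⊆ μ⁺ there is B ∈ D with B ∖ A ∈ I (i.e., the quotient 𝒫(μ⁺)/I has a dense subset of size μ⁺). -/

import Mathlib

open Cardinal Set

/-- A union of at most `c` many sets of size at most `c` has size at most `c`. -/
theorem aux_mk_biUnion_le {ι α : Type 1} (c : Cardinal.{1}) (hc : ℵ₀ ≤ c) (S : Set ι)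
    (A : ι → Set α) (hS : #S ≤ c) (hA : ∀ i ∈ S, #(A i) ≤ c) :
    #(⋃ i ∈ S, A i : Set α) ≤ c := by
  refine (Cardinal.mk_biUnion_le A S).trans ?_
  have h1 : (⨆ x : S, #(A x.1)) ≤ c := ciSup_le' (fun x => hA x.1 x.2)
  calc _ ≤ c * c := mul_le_mul' hS h1
    _ = c := Cardinal.mul_eq_self hc

/-- Injective choice function for at most `c` many sets, each of size at least `c`. -/
theorem aux_inj_choice {ι α : Type 1} (c : Cardinal.{1}) (hι : #ι ≤ c)
    (X : ι → Set α) (hX : ∀ i, c ≤ #(X i)) :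
    ∃ f : ι → α, Function.Injective f ∧ ∀ i, f i ∈ X i := by
  obtain ⟨r, wo, hr⟩ := Cardinal.ord_eq ι
  have key : ∀ (i : ι) (g : ∀ j, r j i → α), ∃ a ∈ X i, ∀ j (h : r j i), g j h ≠ a := by
    intro i g
    by_contra hcon
    push Not at hcon
    have hsub : X i ⊆ Set.range (fun j : {j // r j i} => g j.1 j.2) := by
      intro a ha
      obtain ⟨j, h, e⟩ := hcon a ha
      exact ⟨⟨j, h⟩, e⟩
    have h1 : #(X i) ≤ #{j // r j i} := (Cardinal.mk_le_mk_of_subset hsub).trans Cardinal.mk_range_le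
    have h2 : #{j // r j i} < #ι := by
      have := Cardinal.card_typein_lt (r := r) i hr
      rwa [Ordinal.card_typein] at this
    exact absurd ((hX i).trans h1) (not_le.2 (h2.trans_le hι))
  choose F hF1 hF2 using key
  let f : ι → α := wo.wf.fix F
  have hf : ∀ i, f i = F i (fun j _ => f j) := fun i => wo.wf.fix_eq F i
  have hne : ∀ i j, r j i → f j ≠ f i := by
    intro i j h
    rw [hf i]
    exact hF2 i (fun j _ => f j) j h
  refine ⟨f, ?_, ?_⟩
  · intro i j hij
    rcases trichotomous_of r i j with h | h | h
    · exact absurd hij (hne _ _ h)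
    · exact h
    · exact absurd hij.symm (hne _ _ h)
  · intro i
    rw [hf i]
    exact hF1 _ _

/-- Every nonzero `α < μ⁺` has a cofinal sequence of length `< μ`, for singular `μ`. -/
theorem aux_cofinal_seq (μ : Cardinal.{0}) (hsing : μ.ord.cof < μ) (α : Ordinal.{0})
    (hα : α < (Order.succ μ).ord) (h0 : 0 < α) :
    ∃ δ < μ.ord, ∃ s : Ordinal.{0} → Ordinal.{0}, (∀ i, s i < α) ∧
      ∀ β < α, ∃ i < δ, β ≤ s i := by
  have hcof : α.cof < μ := by
    have h1 : α.cof ≤ μ := (Ordinal.cof_le_card α).trans (Order.lt_succ_iff.1 (Cardinal.lt_ord.1 hα))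
    rcases h1.lt_or_eq with h | h
    · exact h
    · have h2 := Ordinal.cof_ord_cof α
      rw [h] at h2
      exact absurd hsing (by rw [h2]; exact lt_irrefl _)
  obtain ⟨f, hf⟩ := Ordinal.exists_isFundamentalSeq (o := α) rfl
  refine ⟨α.cof.ord, Cardinal.ord_lt_ord.2 hcof,
    fun i => if h : i < α.cof.ord then (f ⟨i, h⟩).1 else 0, ?_, ?_⟩
  · intro i
    dsimp only
    split_ifs with h
    · exact (f ⟨i, h⟩).2
    · exact h0
  · intro β hβ
    obtain ⟨_, ⟨⟨i, hi⟩, rfl⟩, h⟩ := hf.isCofinal_range ⟨β, hβ⟩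
    refine ⟨i, hi, ?_⟩
    have hi' : i < α.cof.ord := hi
    simp only [hi', dif_pos]
    exact h

/-- (Eskew–Sakai) If `μ` is a singular cardinal, then there is no dense normal, fine,
`μ⁺`-complete proper ideal over `μ⁺`: no such ideal admits a family `D` of at most `μ⁺`
many `I`-positive sets that is dense in the quotient `𝒫(μ⁺)/I`. -/
theorem no_dense_ideal_on_successor_of_singular
    (μ : Cardinal.{0}) (hμ : ℵ₀ ≤ μ) (hsing : μ.ord.cof < μ) :
    ¬ ∃ (I : Set (Set Ordinal.{0})) (D : Set (Set Ordinal.{0})),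
      -- members of `I` are subsets of `μ⁺`
      (∀ A ∈ I, A ⊆ Set.Iio (Order.succ μ).ord) ∧
      -- `I` is closed under subsets
      (∀ A ∈ I, ∀ B ⊆ A, B ∈ I) ∧
      -- `I` is `μ⁺`-complete
      (∀ S : Set (Set Ordinal), S ⊆ I →
        #S < Cardinal.lift.{1} (Order.succ μ) → ⋃₀ S ∈ I) ∧
      -- `I` is fine
      (∀ ξ < (Order.succ μ).ord, ({ξ} : Set Ordinal) ∈ I) ∧
      -- `I` is proper
      Set.Iio (Order.succ μ).ord ∉ I ∧
      -- `I` is normal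
      (∀ A : Ordinal → Set Ordinal, (∀ ξ < (Order.succ μ).ord, A ξ ∈ I) →
        {α : Ordinal | α < (Order.succ μ).ord ∧ ∃ ξ < α, α ∈ A ξ} ∈ I) ∧
      -- `D` is a family of `I`-positive sets
      (∀ B ∈ D, B ⊆ Set.Iio (Order.succ μ).ord ∧ B ∉ I) ∧
      -- of size at most `μ⁺`
      #D ≤ Cardinal.lift.{1} (Order.succ μ) ∧
      -- dense in `𝒫(μ⁺)/I`
      (∀ A ⊆ Set.Iio (Order.succ μ).ord, A ∉ I → ∃ B ∈ D, B \ A ∈ I) := by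
  rintro ⟨I, D, hIsub, hdown, hcomp, hfine, hproper, hnormal, hD, hDcard, hdense⟩
  set κ : Ordinal.{0} := (Order.succ μ).ord with hκ
  set c : Cardinal.{1} := Cardinal.lift.{1} μ with hc
  have hc0 : ℵ₀ ≤ c := by rw [hc]; exact Cardinal.aleph0_le_lift.2 hμ
  have hsucc : Cardinal.lift.{1} (Order.succ μ) = Order.succ c := Cardinal.lift_succ μ
  rw [hsucc] at hDcard
  have hIio : ∀ β < κ, #(Set.Iio β) ≤ c := by
    intro β hβ
    rw [Cardinal.mk_Iio_ordinal, hc, Cardinal.lift_le]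
    exact Order.lt_succ_iff.1 (Cardinal.lt_ord.1 hβ)
  have hIic : ∀ β < κ, #(Set.Iic β) ≤ c := by
    intro β hβ
    have hs : Set.Iic β = insert β (Set.Iio β) := by
      ext x; simp [le_iff_eq_or_lt]
    rw [hs]
    refine Cardinal.mk_insert_le.trans ?_
    calc _ ≤ c + 1 := by gcongr; exact hIio β hβ
      _ = c := Cardinal.add_one_eq hc0
  have hIioκ : #(Set.Iio κ) = Order.succ c := by
    rw [Cardinal.mk_Iio_ordinal, hκ, Cardinal.card_ord, hsucc]
  -- unions of at most `μ` many members of `I`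
  have hU : ∀ (S : Set Ordinal.{0}) (A : Ordinal.{0} → Set Ordinal.{0}), #S ≤ c →
      (∀ i ∈ S, A i ∈ I) → (⋃ i ∈ S, A i) ∈ I := by
    intro S A hS hA
    rw [← Set.sUnion_image]
    refine hcomp _ ?_ ?_
    · rintro _ ⟨i, hi, rfl⟩
      exact hA i hi
    · rw [hsucc, Order.lt_succ_iff]
      exact Cardinal.mk_image_le.trans hS
  have hpair : ∀ A ∈ I, ∀ B ∈ I, A ∪ B ∈ I := by
    intro A hA B hB
    rw [← Set.sUnion_pair]
    refine hcomp _ ?_ ?_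
    · rintro X (rfl | rfl) <;> assumption
    · rw [hsucc, Order.lt_succ_iff]
      refine le_trans ?_ hc0
      exact (Set.toFinite ({A, B} : Set (Set Ordinal.{0}))).lt_aleph0.le
  have hbdd : ∀ β < κ, Set.Iic β ∈ I := by
    intro β hβ
    have h := hU (Set.Iic β) (fun x => {x}) (hIic β hβ)
      (fun x hx => hfine x (lt_of_le_of_lt hx hβ))
    rwa [Set.biUnion_of_singleton] at h
  -- cofinal sequences
  have hseq : ∀ α : Ordinal.{0}, ∃ (δ : Ordinal.{0}) (s : Ordinal.{0} → Ordinal.{0}),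
      α < κ → 0 < α → δ < μ.ord ∧ (∀ i, s i < α) ∧ ∀ β < α, ∃ i < δ, β ≤ s i := by
    intro α
    by_cases h : α < κ ∧ 0 < α
    · obtain ⟨δ, h1, s, h2, h3⟩ := aux_cofinal_seq μ hsing α h.1 h.2
      exact ⟨δ, s, fun _ _ => ⟨h1, h2, h3⟩⟩
    · exact ⟨0, id, fun h1 h2 => absurd ⟨h1, h2⟩ h⟩
  choose len s hs using hseq
  have hμc : #(Set.Iio μ.ord) = c := by
    rw [Cardinal.mk_Iio_ordinal, Cardinal.card_ord]
  have hκpos : 0 < κ := by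
    rw [hκ, Cardinal.lt_ord]
    simp
  obtain ⟨δ, hδ, hSpos⟩ : ∃ δ < μ.ord, {α | α < κ ∧ 0 < α ∧ len α = δ} ∉ I := by
    by_contra hcon
    push Not at hcon
    have h1 := hU (Set.Iio μ.ord) (fun δ => {α | α < κ ∧ 0 < α ∧ len α = δ}) hμc.le hcon
    apply hproper
    refine hdown _ (hpair _ h1 _ (hfine 0 hκpos)) _ ?_
    intro α hα
    rcases eq_or_ne α 0 with h | h
    · right; exact h
    · left
      have h0 : 0 < α := pos_iff_ne_zero.2 h
      simp only [Set.mem_iUnion]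
      exact ⟨len α, (hs α hα h0).1, hα, h0, rfl⟩
  set S : Set Ordinal.{0} := {α | α < κ ∧ 0 < α ∧ len α = δ} with hSdef
  have hslt : ∀ α ∈ S, ∀ i, s α i < α := fun α h => (hs α h.1 h.2.1).2.1
  have hscof : ∀ α ∈ S, ∀ β < α, ∃ i < δ, β ≤ s α i := by
    intro α h
    have := (hs α h.1 h.2.1).2.2
    rwa [h.2.2] at this
  have hδc : #(Set.Iio δ) < c := by
    rw [Cardinal.mk_Iio_ordinal, hc, Cardinal.lift_lt]
    exact Cardinal.lt_ord.1 hδ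
  -- the values of the `i`-th coordinate that are taken positively often on `B`
  let N : Ordinal.{0} → Set Ordinal.{0} → Set Ordinal.{0} :=
    fun i B => {γ | γ < κ ∧ {α | α ∈ B ∧ s α i = γ} ∉ I}
  have hmany : ∀ B ⊆ S, B ∉ I → ∃ i < δ, Order.succ c ≤ #(N i B) := by
    intro B hBS hB
    by_contra hcon
    push Not at hcon
    have hN : ∀ i < δ, #(N i B) ≤ c := fun i hi => Order.lt_succ_iff.1 (hcon i hi)
    have hbad : ∀ i < δ, {α | α ∈ B ∧ s α i ∉ N i B} ∈ I := by
      intro i hi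
      refine hdown _ (hnormal (fun ξ => {α | α ∈ B ∧ s α i = ξ ∧ ξ ∉ N i B}) ?_) _ ?_
      · intro ξ hξ
        by_cases h : ξ ∈ N i B
        · refine hdown _ (hfine 0 hκpos) _ ?_
          rintro α ⟨_, _, h'⟩
          exact absurd h h'
        · have h' : {α | α ∈ B ∧ s α i = ξ} ∈ I := by
            by_contra h2
            exact h ⟨hξ, h2⟩
          refine hdown _ h' _ ?_
          rintro α ⟨h1, h2, _⟩
          exact ⟨h1, h2⟩
      · rintro α ⟨h1, h2⟩
        exact ⟨(hBS h1).1, s α i, hslt α (hBS h1) i, h1, rfl, h2⟩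
    have hbadU := hU (Set.Iio δ) (fun i => {α | α ∈ B ∧ s α i ∉ N i B}) hδc.le hbad
    let T : Set Ordinal.{0} := ⋃ i ∈ Set.Iio δ, ⋃ γ ∈ N i B, Set.Iic γ
    have hT : #T ≤ c := by
      refine aux_mk_biUnion_le c hc0 _ _ hδc.le ?_
      intro i hi
      exact aux_mk_biUnion_le c hc0 _ _ (hN i hi) (fun γ hγ => hIic γ hγ.1)
    obtain ⟨β, hβ, hβT⟩ : ∃ β < κ, β ∉ T := by
      by_contra h
      push Not at h
      have h1 : #(Set.Iio κ) ≤ #T := Cardinal.mk_le_mk_of_subset h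
      rw [hIioκ] at h1
      exact absurd (h1.trans hT) (not_le.2 (Order.lt_succ c))
    apply hB
    refine hdown _ (hpair _ hbadU _ (hbdd β hβ)) _ ?_
    intro α hα
    by_cases hαβ : α ≤ β
    · right; exact hαβ
    · left
      obtain ⟨i, hi, hle⟩ := hscof α (hBS hα) β (not_le.1 hαβ)
      simp only [Set.mem_iUnion]
      refine ⟨i, hi, hα, fun hmem => hβT ?_⟩
      simp only [T, Set.mem_iUnion]
      exact ⟨i, hi, s α i, hmem, hle⟩
  -- injective choice of values
  have hchoice : ∀ i : Ordinal.{0}, ∃ f : D × Set.Iio κ → Ordinal.{0}, Function.Injective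
      (fun p : {p : D × Set.Iio κ // Order.succ c ≤ #(N i (p.1.1 ∩ S))} => f p.1) ∧
      ∀ p : D × Set.Iio κ, Order.succ c ≤ #(N i (p.1.1 ∩ S)) → f p ∈ N i (p.1.1 ∩ S) := by
    intro i
    have hcard : #{p : D × Set.Iio κ // Order.succ c ≤ #(N i (p.1.1 ∩ S))} ≤ Order.succ c := by
      refine (Cardinal.mk_subtype_le _).trans ?_
      rw [Cardinal.mk_prod, Cardinal.lift_id, Cardinal.lift_id, hIioκ]
      calc _ ≤ Order.succ c * Order.succ c := mul_le_mul' hDcard le_rfl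
        _ = Order.succ c := Cardinal.mul_eq_self (hc0.trans (Order.le_succ c))
    obtain ⟨f, hf1, hf2⟩ := aux_inj_choice (Order.succ c) hcard
      (fun p => N i (p.1.1.1 ∩ S)) (fun p => p.2)
    classical
    refine ⟨fun p => if h : Order.succ c ≤ #(N i (p.1.1 ∩ S)) then f ⟨p, h⟩ else 0, ?_, ?_⟩
    · intro p q hpq
      have hp := p.2
      have hq := q.2
      simp only [hp, hq, dif_pos] at hpq
      exact hf1 hpq
    · intro p hp
      simp only [hp, dif_pos]
      exact hf2 ⟨p, hp⟩
  choose f hfinj hfmem using hchoice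
  -- decode
  have hdecode : ∀ i : Ordinal.{0}, ∃ F : Ordinal.{0} → Ordinal.{0},
      ∀ p : D × Set.Iio κ, Order.succ c ≤ #(N i (p.1.1 ∩ S)) → F (f i p) = p.2.1 := by
    intro i
    classical
    refine ⟨fun γ => if h : ∃ p : {p : D × Set.Iio κ // Order.succ c ≤ #(N i (p.1.1 ∩ S))},
      f i p.1 = γ then h.choose.1.2.1 else 0, ?_⟩
    intro p hp
    have h : ∃ q : {p : D × Set.Iio κ // Order.succ c ≤ #(N i (p.1.1 ∩ S))},
      f i q.1 = f i p := ⟨⟨p, hp⟩, rfl⟩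
    have h2 : h.choose = ⟨p, hp⟩ := hfinj i h.choose_spec
    dsimp only
    rw [dif_pos h, h2]
  choose F hF using hdecode
  have hE : ∀ ζ < κ, {α | α ∈ S ∧ ∀ i < δ, F i (s α i) ≠ ζ} ∈ I := by
    intro ζ hζ
    by_contra hpos
    obtain ⟨B, hBD, hBE⟩ := hdense _ (fun α hα => hα.1.1) hpos
    have hBS : B ∩ S ∉ I := by
      intro h
      apply (hD B hBD).2
      refine hdown _ (hpair _ h _ hBE) _ ?_
      intro α hα
      by_cases hS : α ∈ S
      · left; exact ⟨hα, hS⟩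
      · right; exact ⟨hα, fun h => hS h.1⟩
    obtain ⟨i, hi, hNi⟩ := hmany (B ∩ S) Set.inter_subset_right hBS
    have h1 := hfmem i (⟨B, hBD⟩, ⟨ζ, hζ⟩) hNi
    apply h1.2
    refine hdown _ hBE _ ?_
    rintro α ⟨hα, hsα⟩
    refine ⟨hα.1, fun hbad => hbad.2 i hi ?_⟩
    rw [hsα]
    exact hF i (⟨B, hBD⟩, ⟨ζ, hζ⟩) hNi
  have hμκ : μ.ord ≤ κ := Cardinal.ord_le_ord.2 (Order.le_succ μ)
  have hEU := hU (Set.Iio μ.ord) (fun ζ => {α | α ∈ S ∧ ∀ i < δ, F i (s α i) ≠ ζ}) hμc.le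
    (fun ζ hζ => hE ζ (lt_of_lt_of_le hζ hμκ))
  apply hSpos
  refine hdown _ hEU _ ?_
  intro α hα
  by_contra hcon
  simp only [Set.mem_iUnion, not_exists] at hcon
  have hsub : Set.Iio μ.ord ⊆ (fun i => F i (s α i)) '' Set.Iio δ := by
    intro ζ hζ
    have h := hcon ζ hζ
    by_contra h2
    exact h ⟨hα, fun i hi e => h2 ⟨i, hi, e⟩⟩
  have h1 : c ≤ #(Set.Iio δ) := by
    rw [← hμc]
    exact (Cardinal.mk_le_mk_of_subset hsub).trans Cardinal.mk_image_le
  exact absurd h1 (not_le.2 hδc)
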